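/- Let I = (t₀, t₀+T) and let b^ν : I×ℝ^d → ℝ^d be continuously differentiable in x, a^ν : I×ℝ^d → ℝ^{d×d} symmetric and twice continuously differentiable in x, and Θ : I×ℝ^d → ℝ^d continuously differentiable in x. Let ρ^μ, ρ^ν : I×ℝ^d → (0,∞) be continuously differentiable in t and twice continuously differentiable in x, satisfying pointwise ∂_t ρ^ν = L^{ν*} ρ^ν and ∂_t ρ^μ = L^{ν*} ρ^μ − Σ_i ∂_{x_i}(Θ_i ρ^μ), where L^{ν*} is the formal adjoint with coefficients (b^ν(t,·), a^ν(t,·)). Set η := ρ^μ/ρ^ν. Then for every φ ∈ C²((0,∞)), pointwise on I×ℝ^d: ∂_t( φ(η)·ρ^ν ) = L^{ν*}( φ(η)·ρ^ν ) − (1/2)·ρ^ν·φ″(η)·⟨a^ν ∇η, ∇η⟩ − φ′(η)·Σ_i ∂_{x_i}(Θ_i ρ^μ). -/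

import Mathlib

open MeasureTheory Set

noncomputable section

/-- Partial derivative `∂_{x_i} f(x)` on `ℝ^d = (Fin d → ℝ)`. -/
def pd {d : ℕ} (f : (Fin d → ℝ) → ℝ) (i : Fin d) (x : Fin d → ℝ) : ℝ :=
  fderiv ℝ f x (Pi.single i 1)

/-- Second partial derivative `∂²_{x_i x_j} f(x)`. -/
def pd2 {d : ℕ} (f : (Fin d → ℝ) → ℝ) (i j : Fin d) (x : Fin d → ℝ) : ℝ :=
  pd (pd f j) i x

/-- Generator `L f = Σ_i b_i ∂_{x_i} f + ½ Σ_{i,j} a_{ij} ∂²_{x_i x_j} f`. -/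
def gen {d : ℕ} (b : (Fin d → ℝ) → Fin d → ℝ) (a : (Fin d → ℝ) → Fin d → Fin d → ℝ)
    (f : (Fin d → ℝ) → ℝ) (x : Fin d → ℝ) : ℝ :=
  (∑ i, b x i * pd f i x) + (1 / 2) * ∑ i, ∑ j, a x i j * pd2 f i j x

/-- Formal `L²(dx)`-adjoint `L* ρ = −Σ_i ∂_{x_i}(b_i ρ) + ½ Σ_{i,j} ∂²_{x_i x_j}(a_{ij} ρ)`. -/
def adj {d : ℕ} (b : (Fin d → ℝ) → Fin d → ℝ) (a : (Fin d → ℝ) → Fin d → Fin d → ℝ)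
    (ρ : (Fin d → ℝ) → ℝ) (x : Fin d → ℝ) : ℝ :=
  (- ∑ i, pd (fun y => b y i * ρ y) i x)
    + (1 / 2) * ∑ i, ∑ j, pd2 (fun y => a y i j * ρ y) i j x

theorem pd_mul {d : ℕ} {f g : (Fin d → ℝ) → ℝ} {x : Fin d → ℝ} (i : Fin d)
    (hf : DifferentiableAt ℝ f x) (hg : DifferentiableAt ℝ g x) :
    pd (fun y => f y * g y) i x = pd f i x * g x + f x * pd g i x := by
  simp only [pd, fderiv_fun_mul hf hg, add_apply, smul_apply, smul_eq_mul]
  ring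

theorem pd_add {d : ℕ} {f g : (Fin d → ℝ) → ℝ} {x : Fin d → ℝ} (i : Fin d)
    (hf : DifferentiableAt ℝ f x) (hg : DifferentiableAt ℝ g x) :
    pd (fun y => f y + g y) i x = pd f i x + pd g i x := by
  simp only [pd, fderiv_fun_add hf hg, add_apply]

theorem pd_comp {d : ℕ} {φ : ℝ → ℝ} {η : (Fin d → ℝ) → ℝ} {x : Fin d → ℝ} (i : Fin d)
    (hφ : DifferentiableAt ℝ φ (η x)) (hη : DifferentiableAt ℝ η x) :
    pd (fun y => φ (η y)) i x = deriv φ (η x) * pd η i x := by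
  have h : HasFDerivAt (fun y => φ (η y)) (deriv φ (η x) • fderiv ℝ η x) x :=
    hφ.hasDerivAt.comp_hasFDerivAt x hη.hasFDerivAt
  simp only [pd, h.fderiv, smul_apply, smul_eq_mul]

theorem ContDiff.differentiable_pd {d : ℕ} {f : (Fin d → ℝ) → ℝ} (hf : ContDiff ℝ 2 f)
    (i : Fin d) : Differentiable ℝ (pd f i) := by
  have h : ContDiff ℝ 1 (fderiv ℝ f) := hf.fderiv_right (by norm_num)
  exact (h.clm_apply contDiff_const).differentiable (by norm_num)

theorem pd2_mul {d : ℕ} {f g : (Fin d → ℝ) → ℝ} (hf : ContDiff ℝ 2 f) (hg : ContDiff ℝ 2 g)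
    (i j : Fin d) (x : Fin d → ℝ) :
    pd2 (fun y => f y * g y) i j x =
      pd2 f i j x * g x + pd f j x * pd g i x + pd f i x * pd g j x + f x * pd2 g i j x := by
  have hf' : Differentiable ℝ f := hf.differentiable (by norm_num)
  have hg' : Differentiable ℝ g := hg.differentiable (by norm_num)
  have hfj := hf.differentiable_pd j
  have hgj := hg.differentiable_pd j
  have h : pd (fun y => f y * g y) j = fun y => pd f j y * g y + f y * pd g j y :=
    funext fun y => pd_mul j (hf' y) (hg' y)
  rw [pd2, h, pd_add i ((hfj x).fun_mul (hg' x)) ((hf' x).fun_mul (hgj x)),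
    pd_mul i (hfj x) (hg' x), pd_mul i (hf' x) (hgj x)]
  simp only [pd2]
  ring

theorem pd2_comp {d : ℕ} {φ : ℝ → ℝ} {η : (Fin d → ℝ) → ℝ}
    (hφ : ContDiffOn ℝ 2 φ (Ioi 0)) (hη : ContDiff ℝ 2 η) (hpos : ∀ x, 0 < η x)
    (i j : Fin d) (x : Fin d → ℝ) :
    pd2 (fun y => φ (η y)) i j x =
      deriv (deriv φ) (η x) * pd η i x * pd η j x + deriv φ (η x) * pd2 η i j x := by
  have hφ' : ContDiffOn ℝ 1 (deriv φ) (Ioi 0) := hφ.deriv_of_isOpen isOpen_Ioi (by norm_num)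
  have hd : ∀ y, DifferentiableAt ℝ φ (η y) := fun y =>
    (hφ.contDiffAt (Ioi_mem_nhds (hpos y))).differentiableAt (by norm_num)
  have hd' : DifferentiableAt ℝ (deriv φ) (η x) :=
    (hφ'.contDiffAt (Ioi_mem_nhds (hpos x))).differentiableAt (by norm_num)
  have hη' : Differentiable ℝ η := hη.differentiable (by norm_num)
  have h : pd (fun y => φ (η y)) j = fun y => deriv φ (η y) * pd η j y :=
    funext fun y => pd_comp j (hd y) (hη' y)
  rw [pd2, h, pd_mul (f := fun y => deriv φ (η y)) i (hd'.comp x (hη' x))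
    (hη.differentiable_pd j x), pd_comp i hd' (hη' x)]
  rfl

/-- Chain rule for the formal adjoint applied to `φ(η) u`. -/
theorem adj_comp_mul {d : ℕ} {b : (Fin d → ℝ) → Fin d → ℝ}
    {a : (Fin d → ℝ) → Fin d → Fin d → ℝ} {φ : ℝ → ℝ} {η u : (Fin d → ℝ) → ℝ}
    (hb : ∀ i, ContDiff ℝ 1 fun y => b y i) (ha : ∀ i j, ContDiff ℝ 2 fun y => a y i j)
    (hφ : ContDiffOn ℝ 2 φ (Ioi 0)) (hη : ContDiff ℝ 2 η) (hpos : ∀ x, 0 < η x)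
    (hu : ContDiff ℝ 2 u) (x : Fin d → ℝ) :
    adj b a (fun y => φ (η y) * u y) x =
      (φ (η x) - deriv φ (η x) * η x) * adj b a u x
        + deriv φ (η x) * adj b a (fun y => η y * u y) x
        + (1 / 2) * u x * deriv (deriv φ) (η x) *
          ∑ i, ∑ j, a x i j * pd η j x * pd η i x := by
  have hψ : ContDiff ℝ 2 fun y => φ (η y) := contDiff_iff_contDiffAt.2 fun y =>
    (hφ.contDiffAt (Ioi_mem_nhds (hpos y))).comp y hη.contDiffAt
  have hd : DifferentiableAt ℝ φ (η x) :=
    (hφ.contDiffAt (Ioi_mem_nhds (hpos x))).differentiableAt (by norm_num)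
  have hη' : DifferentiableAt ℝ η x := hη.differentiable (by norm_num) x
  have hψ' : DifferentiableAt ℝ (fun y => φ (η y)) x := hψ.differentiable (by norm_num) x
  have first_order : ∀ i, pd (fun y => b y i * (φ (η y) * u y)) i x =
      (φ (η x) - deriv φ (η x) * η x) * pd (fun y => b y i * u y) i x
        + deriv φ (η x) * pd (fun y => b y i * (η y * u y)) i x := by
    intro i
    have hw : DifferentiableAt ℝ (fun y => b y i * u y) x :=
      ((hb i).differentiable (by norm_num) x).mul (hu.differentiable (by norm_num) x)
    simp only [mul_left_comm (b _ i)]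
    rw [pd_mul i hψ' hw, pd_mul i hη' hw, pd_comp i hd hη']
    ring
  have second_order : ∀ i j, pd2 (fun y => a y i j * (φ (η y) * u y)) i j x =
      (φ (η x) - deriv φ (η x) * η x) * pd2 (fun y => a y i j * u y) i j x
        + deriv φ (η x) * pd2 (fun y => a y i j * (η y * u y)) i j x
        + u x * deriv (deriv φ) (η x) * (a x i j * pd η j x * pd η i x) := by
    intro i j
    have hw : ContDiff ℝ 2 (fun y => a y i j * u y) := (ha i j).mul hu
    simp only [mul_left_comm (a _ i j)]
    rw [pd2_mul hψ hw, pd2_mul hη hw, pd2_comp hφ hη hpos, pd_comp i hd hη', pd_comp j hd hη']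
    ring
  simp only [adj, first_order, second_order, Finset.sum_add_distrib, ← Finset.mul_sum]
  ring

/-- evolution identity for `φ(η)·ρ^ν`, where `η = ρ^μ/ρ^ν` and
`ρ^ν, ρ^μ` solve `∂_t ρ^ν = L^{ν*}ρ^ν` and `∂_t ρ^μ = L^{ν*}ρ^μ − div(Θρ^μ)`:
`∂_t(φ(η)ρ^ν) = L^{ν*}(φ(η)ρ^ν) − ½ ρ^ν φ″(η)⟨a^ν∇η,∇η⟩ − φ′(η)·div(Θρ^μ)`. -/
theorem evolution_of_phi_eta (d : ℕ) (t₀ T : ℝ) (hT : 0 < T)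
    (bν : ℝ → (Fin d → ℝ) → Fin d → ℝ)
    (aν : ℝ → (Fin d → ℝ) → Fin d → Fin d → ℝ)
    (Θ : ℝ → (Fin d → ℝ) → Fin d → ℝ)
    (hb : ∀ t i, ContDiff ℝ 1 fun y => bν t y i)
    (ha : ∀ t i j, ContDiff ℝ 2 fun y => aν t y i j)
    (hsym : ∀ t y i j, aν t y i j = aν t y j i)
    (hΘ : ∀ t i, ContDiff ℝ 1 fun y => Θ t y i)
    (ρμ ρν : ℝ → (Fin d → ℝ) → ℝ)
    (hρμpos : ∀ t x, 0 < ρμ t x) (hρνpos : ∀ t x, 0 < ρν t x)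
    (hρμx : ∀ t, ContDiff ℝ 2 (ρμ t)) (hρνx : ∀ t, ContDiff ℝ 2 (ρν t))
    (hρνt : ∀ t ∈ Ioo t₀ (t₀ + T), ∀ x,
      HasDerivAt (fun s => ρν s x) (adj (bν t) (aν t) (ρν t) x) t)
    (hρμt : ∀ t ∈ Ioo t₀ (t₀ + T), ∀ x,
      HasDerivAt (fun s => ρμ s x)
        (adj (bν t) (aν t) (ρμ t) x - ∑ i, pd (fun y => Θ t y i * ρμ t y) i x) t)
    (φ : ℝ → ℝ) (hφ : ContDiffOn ℝ 2 φ (Ioi 0))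
    (t : ℝ) (ht : t ∈ Ioo t₀ (t₀ + T)) (x : Fin d → ℝ) :
    HasDerivAt (fun s => φ (ρμ s x / ρν s x) * ρν s x)
      (adj (bν t) (aν t) (fun y => φ (ρμ t y / ρν t y) * ρν t y) x
        - (1 / 2) * ρν t x * deriv (deriv φ) (ρμ t x / ρν t x) *
            (∑ i, ∑ j, aν t x i j * pd (fun y => ρμ t y / ρν t y) j x *
              pd (fun y => ρμ t y / ρν t y) i x)
        - deriv φ (ρμ t x / ρν t x) * ∑ i, pd (fun y => Θ t y i * ρμ t y) i x) t := by
  have hφd : DifferentiableAt ℝ φ (ρμ t x / ρν t x) :=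
    (hφ.contDiffAt (Ioi_mem_nhds (div_pos (hρμpos t x) (hρνpos t x)))).differentiableAt
      (by norm_num)
  have hν := hρνt t ht x
  have hη := (hρμt t ht x).div hν (hρνpos t x).ne'
  have hmul : (fun y => ρμ t y / ρν t y * ρν t y) = ρμ t :=
    funext fun y => div_mul_cancel₀ _ (hρνpos t y).ne'
  have hadj := adj_comp_mul (η := fun y => ρμ t y / ρν t y) (hb t) (ha t) hφ
    ((hρμx t).div (hρνx t) fun y => (hρνpos t y).ne')
    (fun y => div_pos (hρμpos t y) (hρνpos t y)) (hρνx t) x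
  rw [hmul] at hadj
  have h0 : ρν t x ≠ 0 := (hρνpos t x).ne'
  refine ((hφd.hasDerivAt.comp t hη).mul hν).congr_deriv ?_
  rw [hadj]
  simp only [Function.comp_apply, Pi.div_apply]
  field_simp
  ring

end
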